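/- Let R be a commutative ring and E : R → R a map satisfying E(0) = 1 and E(u + v) = E(u)·E(v) for all u, v ∈ R. Let S and T be finite types, x : S → R, y : T → R, and a : S → T → ℕ. Suppose Q : S → T → R and Q′ : T → S → R satisfy Q(s,t)·(1 − E(y(t) − x(s))) = x(s) − y(t) and Q′(t,s)·(1 − E(x(s) − y(t))) = y(t) − x(s) for all s ∈ S, t ∈ T, and suppose each element 1 − E(y(t) − x(s)) is not a zero divisor in R. Then ∏_{s∈S} ∏_{t∈T} Q(s,t)^{a(s,t)} = E(∑_{s∈S} ∑_{t∈T} a(s,t)·(x(s) − y(t))) · ∏_{s∈S} ∏_{t∈T} Q′(t,s)^{a(s,t)}. -/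

import Mathlib

open Finset

section Exponential

variable {R : Type*} [CommRing R] {E : R → R}

/-- A map turning sums into products, as a monoid homomorphism out of `Multiplicative R`. -/
def expHom (hE0 : E 0 = 1) (hEadd : ∀ u v : R, E (u + v) = E u * E v) :
    Multiplicative R →* R where
  toFun u := E u.toAdd
  map_one' := hE0
  map_mul' u v := hEadd u.toAdd v.toAdd

theorem exp_sum_nsmul (hE0 : E 0 = 1) (hEadd : ∀ u v : R, E (u + v) = E u * E v)
    {ι : Type*} (A : Finset ι) (n : ι → ℕ) (f : ι → R) :
    E (∑ i ∈ A, n i • f i) = ∏ i ∈ A, E (f i) ^ n i := by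
  have h := map_prod (expHom hE0 hEadd) (fun i => Multiplicative.ofAdd (f i) ^ n i) A
  simp only [map_pow] at h
  simpa [expHom, toAdd_prod, -map_prod] using h

/-- The Todd factors of `d` and `-d` differ by the factor `E d`. -/
theorem todd_factor_eq_exp_mul (hE0 : E 0 = 1) (hEadd : ∀ u v : R, E (u + v) = E u * E v)
    {d q q' : R} (hq : q * (1 - E (-d)) = d) (hq' : q' * (1 - E d) = -d)
    (hreg : 1 - E (-d) ∈ nonZeroDivisors R) : q = E d * q' := by
  have hinv : E d * E (-d) = 1 := by rw [← hEadd, add_neg_cancel, hE0]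
  refine (mul_cancel_right_mem_nonZeroDivisors hreg).mp ?_
  linear_combination hq + hq' + q' * hinv

end Exponential

/-- Abstract form of equations (3.1)/(3.2) of the paper:
`∏ Q(s,t)^{a(s,t)} = E(∑ a(s,t)·(x(s) − y(t))) · ∏ Q′(t,s)^{a(s,t)}`. -/
theorem todd_prod_compare {R : Type*} [CommRing R] (E : R → R)
    (hE0 : E 0 = 1) (hEadd : ∀ u v : R, E (u + v) = E u * E v)
    {S T : Type*} [Fintype S] [Fintype T]
    (x : S → R) (y : T → R) (a : S → T → ℕ)
    (Q : S → T → R) (Q' : T → S → R)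
    (hQ : ∀ (s : S) (t : T), Q s t * (1 - E (y t - x s)) = x s - y t)
    (hQ' : ∀ (s : S) (t : T), Q' t s * (1 - E (x s - y t)) = y t - x s)
    (hreg : ∀ (s : S) (t : T), (1 - E (y t - x s)) ∈ nonZeroDivisors R) :
    (∏ s : S, ∏ t : T, Q s t ^ a s t) =
      E (∑ s : S, ∑ t : T, a s t • (x s - y t)) *
        ∏ s : S, ∏ t : T, Q' t s ^ a s t := by
  have hfactor (s : S) (t : T) : Q s t = E (x s - y t) * Q' t s :=
    todd_factor_eq_exp_mul hE0 hEadd (by rw [neg_sub]; exact hQ s t)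
      (by rw [neg_sub]; exact hQ' s t) (by rw [neg_sub]; exact hreg s t)
  simp only [← Fintype.sum_prod_type', ← Fintype.prod_prod_type']
  rw [exp_sum_nsmul hE0 hEadd, ← prod_mul_distrib]
  exact prod_congr rfl fun p _ => by rw [hfactor, mul_pow]
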